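/- Let f : SO(3) → ℝ have Wigner decomposition of maximum degree L−1 and L²-norm C < ∞. Consider the sampling grid α_{k₁} = 2πk₁/K, γ_{k₃} = 2πk₃/K (k₁,k₃ = 0,…,K), and β_{k₂} = arccos(x_{k₂}) with x_i the K-point Gauss–Legendre quadrature nodes on [−1,1]. If K > K₀ where K₀ = 8π L^{5/2} (C/√3)/ε, then the difference between the maximum of f over the sampled grid points and the true maximum of f over SO(3) is smaller than ε. -/

import Mathlib

/-!
STATEMENT 5: Let `f : SO(3) → ℝ` (in ZYZ Euler-angle coordinates
`(α,β,γ) ∈ [0,2π] × [0,π] × [0,2π]`) have a Wigner decomposition of maximum degree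
`L−1` and `L²`-norm `C`, so that (cf. Statement 2) it is Lipschitz with constant
`(4C/√3)·L^{5/2}` with respect to the Euler-angle (sup-product) metric.
Consider the grid `α_{k₁} = 2πk₁/K`, `γ_{k₃} = 2πk₃/K` (`k₁,k₃ = 0,…,K`) and
`β_{k₂} = arccos(x_{k₂})` with `x_i` the `K` Gauss–Legendre nodes (the roots of the
`K`-th Legendre polynomial on `(−1,1)`).  If `K > K₀ = 8π L^{5/2} (C/√3)/ε`, then the
difference between the true maximum of `f` and the maximum over the sampled grid is
smaller than `ε`.
-/

noncomputable section
open Real Polynomial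

/-- The `K`-th Legendre polynomial (Rodrigues' formula, up to the nonzero
normalization `1/(2^K K!)`, which does not affect the roots). -/
def legendrePoly (K : ℕ) : Polynomial ℝ :=
  derivative^[K] ((X ^ 2 - 1) ^ K)

lemma legendre_ode_aux (K j : ℕ) :
    (X ^ 2 - 1 : ℝ[X]) * derivative^[j + 2] ((X ^ 2 - 1) ^ K)
      + C (2 * ((j : ℝ) + 1) - 2 * K) * X * derivative^[j + 1] ((X ^ 2 - 1) ^ K)
      + C (((j : ℝ) + 1) * j - 2 * K * (j + 1)) * derivative^[j] ((X ^ 2 - 1) ^ K) = 0 := by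
  induction j with
  | zero =>
    have h0 : (X ^ 2 - 1 : ℝ[X]) * derivative ((X ^ 2 - 1) ^ K)
        = C (2 * (K : ℝ)) * X * (X ^ 2 - 1) ^ K := by
      rcases K with _ | k
      · simp
      · rw [derivative_pow]
        simp only [derivative_sub, derivative_X_pow, derivative_one, Nat.add_sub_cancel,
          map_mul, map_natCast, Nat.cast_ofNat, map_ofNat]
        ring
    have h1 := congrArg derivative h0
    simp only [derivative_mul, derivative_sub, derivative_X_pow, derivative_one, derivative_C,
      derivative_X] at h1
    simp only [Function.iterate_succ_apply', Function.iterate_zero, id, Nat.cast_zero]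
    simp only [map_sub, map_mul, map_add, map_natCast, map_zero, map_one, map_ofNat,
      Nat.cast_ofNat] at h1 ⊢
    linear_combination h1
  | succ j ih =>
    have h1 := congrArg derivative ih
    simp only [derivative_mul, derivative_sub, derivative_add, derivative_X_pow, derivative_one,
      derivative_C, derivative_X, derivative_zero, ← Function.iterate_succ_apply' derivative] at h1
    simp only [map_sub, map_mul, map_add, map_natCast, map_zero, map_one, map_ofNat,
      Nat.cast_ofNat, Nat.cast_add, Nat.cast_one, Nat.succ_eq_add_one] at h1 ⊢
    linear_combination h1

lemma legendre_ode (K : ℕ) (t : ℝ) :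
    (1 - t ^ 2) * (derivative (derivative (legendrePoly K))).eval t
      - 2 * t * (derivative (legendrePoly K)).eval t
      + K * (K + 1) * (legendrePoly K).eval t = 0 := by
  have h := congrArg (eval t) (legendre_ode_aux K K)
  simp only [Function.iterate_succ_apply', eval_add, eval_mul, eval_sub, eval_pow, eval_X,
    eval_one, eval_C, eval_zero] at h
  unfold legendrePoly
  linear_combination -h

lemma legendre_ne_zero (K : ℕ) : legendrePoly K ≠ 0 := by
  intro h
  have h1 := congrArg (fun p => coeff p K) h
  have hm : ((X ^ 2 - 1 : ℝ[X]) ^ K).Monic := by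
    apply Monic.pow
    have := monic_X_pow_sub_C (1 : ℝ) (n := 2) (by norm_num)
    simpa using this
  have hd : ((X ^ 2 - 1 : ℝ[X]) ^ K).natDegree = K + K := by
    rw [natDegree_pow]
    have := natDegree_X_pow_sub_C (n := 2) (r := (1 : ℝ))
    simp only [map_one] at this
    rw [this]; ring
  simp only [legendrePoly, coeff_iterate_derivative, coeff_zero] at h1
  rw [← hd, hm.coeff_natDegree] at h1
  simp [hd, Nat.descFactorial_eq_zero_iff_lt] at h1

lemma legendre_natDegree_le (K : ℕ) : (legendrePoly K).natDegree ≤ K := by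
  unfold legendrePoly
  refine (natDegree_iterate_derivative _ _).trans ?_
  rw [natDegree_pow]
  have := natDegree_X_pow_sub_C (n := 2) (r := (1 : ℝ))
  simp only [map_one] at this
  rw [this]; omega

lemma roots_all (K : ℕ) (x : Fin K → ℝ) (hx : ∀ i, (legendrePoly K).eval (x i) = 0)
    (hxinj : Function.Injective x) (t : ℝ) (ht : (legendrePoly K).eval t = 0) :
    ∃ i, x i = t := by
  classical
  have hsub : Finset.univ.image x ⊆ (legendrePoly K).roots.toFinset := by
    intro y hy
    obtain ⟨i, -, rfl⟩ := Finset.mem_image.1 hy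
    simp [legendre_ne_zero, hx i]
  have hcard : (legendrePoly K).roots.toFinset.card ≤ (Finset.univ.image x).card := by
    rw [Finset.card_image_of_injective _ hxinj, Finset.card_fin]
    exact (Multiset.toFinset_card_le _).trans ((card_roots' _).trans (legendre_natDegree_le K))
  have heq := Finset.eq_of_subset_of_card_le hsub hcard
  have hmem : t ∈ (legendrePoly K).roots.toFinset := by
    simp [legendre_ne_zero, ht]
  rw [← heq] at hmem
  simpa using hmem

lemma sturm_pos (K : ℕ) (P : ℝ[X])
    (hode : ∀ t : ℝ, (1 - t ^ 2) * (derivative (derivative P)).eval t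
      - 2 * t * (derivative P).eval t + K * (K + 1) * P.eval t = 0)
    (a b : ℝ) (ha : 0 < a) (hb : b < π) (hab : b = a + π / (K + 1 / 2))
    (hpos : ∀ θ ∈ Set.Icc a b, 0 < P.eval (cos θ)) : False := by
  set m : ℝ := K + 1 / 2 with hm
  have hm0 : 0 < m := by positivity
  have hle : a ≤ b := by rw [hab]; have := div_pos pi_pos hm0; linarith
  have hs : ∀ θ ∈ Set.Icc a b, 0 < sin θ := fun θ h =>
    sin_pos_of_pos_of_lt_pi (by linarith [h.1]) (by linarith [h.2])
  let W : ℝ → ℝ := fun θ => √(sin θ) * P.eval (cos θ) * (m * cos (m * (θ - a)))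
    - (cos θ / (2 * √(sin θ)) * P.eval (cos θ)
        - sin θ * √(sin θ) * (derivative P).eval (cos θ)) * sin (m * (θ - a))
  have hW : ∀ θ ∈ Set.Icc a b, HasDerivAt W
      (1 / (4 * sin θ ^ 2) * (√(sin θ) * P.eval (cos θ)) * sin (m * (θ - a))) θ := by
    intro θ hθ
    have hsθ := hs θ hθ
    have hr : 0 < √(sin θ) := sqrt_pos.2 hsθ
    have hsin := hasDerivAt_sin θ
    have hcos := hasDerivAt_cos θ
    have hsq := hsin.sqrt hsθ.ne'
    have hP := (P.hasDerivAt (cos θ)).comp θ hcos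
    have hP' := ((derivative P).hasDerivAt (cos θ)).comp θ hcos
    have hlin : HasDerivAt (fun θ : ℝ => m * (θ - a)) m θ := by
      simpa using ((hasDerivAt_id θ).sub_const a).const_mul m
    have hA := (hsq.mul hP).mul (hlin.cos.const_mul m)
    have hB := (((hcos.div (hsq.const_mul 2) (by positivity)).mul hP).sub
      ((hsin.mul hsq).mul hP')).mul hlin.sin
    refine (hA.sub hB).congr_deriv ?_
    have ho := hode (cos θ)
    have hsc := sin_sq_add_cos_sq θ
    simp only [Function.comp, Pi.mul_apply, Pi.div_apply, Pi.sub_apply]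
    generalize eval (cos θ) (derivative (derivative P)) = p2 at *
    generalize eval (cos θ) (derivative P) = p1 at *
    generalize eval (cos θ) P = p0 at *
    have hrs : sin θ = √(sin θ) ^ 2 := (sq_sqrt hsθ.le).symm
    generalize √(sin θ) = r at *
    rw [hrs] at hsc ⊢
    generalize cos θ = c at *
    generalize sin (m * (θ - a)) = S
    generalize cos (m * (θ - a)) = T
    have hKm : (K : ℝ) = m - 1 / 2 := by rw [hm]; ring
    rw [hKm] at ho
    field_simp
    linear_combination (-16 * r ^ 4 * S) * ho + (-16 * S * r ^ 4 * p2 + 4 * S * p0) * hsc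
  have hmono : MonotoneOn W (Set.Icc a b) := by
    apply monotoneOn_of_deriv_nonneg (convex_Icc a b)
    · exact fun θ h => (hW θ h).continuousAt.continuousWithinAt
    · exact fun θ h => (hW θ (interior_subset h)).differentiableAt.differentiableWithinAt
    · intro θ h
      have h' := interior_subset h
      rw [(hW θ h').deriv]
      have h1 := hpos θ h'
      have h2 : 0 ≤ sin (m * (θ - a)) := by
        apply sin_nonneg_of_nonneg_of_le_pi
        · exact mul_nonneg hm0.le (by linarith [h'.1])
        · have : θ - a ≤ π / m := by linarith [h'.2]
          rw [le_div_iff₀ hm0] at this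
          linarith
      positivity
  have h := hmono (Set.left_mem_Icc.2 hle) (Set.right_mem_Icc.2 hle) hle
  have hba : m * (b - a) = π := by rw [hab]; field_simp; ring
  simp only [W, hba, sub_self, mul_zero, sin_zero, cos_zero, sin_pi, cos_pi] at h
  have e1 := mul_pos (mul_pos (sqrt_pos.2 (hs a ⟨le_rfl, hle⟩)) (hpos a ⟨le_rfl, hle⟩)) hm0
  have e2 := mul_pos (mul_pos (sqrt_pos.2 (hs b ⟨hle, le_rfl⟩)) (hpos b ⟨hle, le_rfl⟩)) hm0
  linarith

lemma exists_zero (K : ℕ) (a b : ℝ) (ha : 0 < a) (hb : b < π)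
    (hab : b = a + π / (K + 1 / 2)) :
    ∃ θ ∈ Set.Icc a b, (legendrePoly K).eval (cos θ) = 0 := by
  by_contra! hne
  have hle : a ≤ b := by rw [hab]; have : 0 < π / ((K : ℝ) + 1 / 2) := by positivity
                         linarith
  have hcont : ContinuousOn (fun θ => (legendrePoly K).eval (cos θ)) (Set.Icc a b) :=
    ((legendrePoly K).continuous.comp continuous_cos).continuousOn
  have hpre : IsPreconnected (Set.Icc a b) := isPreconnected_Icc
  have hcase : (∀ θ ∈ Set.Icc a b, 0 < (legendrePoly K).eval (cos θ)) ∨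
      (∀ θ ∈ Set.Icc a b, 0 < (-legendrePoly K).eval (cos θ)) := by
    by_contra! hcon
    obtain ⟨⟨s, hs, hs'⟩, t, ht, ht'⟩ := hcon
    rw [eval_neg] at ht'
    obtain ⟨z, hz, hz'⟩ := hpre.intermediate_value hs ht hcont
      (show (0 : ℝ) ∈ Set.Icc _ _ from ⟨hs', by simpa using ht'⟩)
    exact hne z hz hz'
  rcases hcase with h | h
  · exact sturm_pos K _ (legendre_ode K) a b ha hb hab h
  · refine sturm_pos K _ (fun t => ?_) a b ha hb hab h
    simp only [derivative_neg, eval_neg]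
    linear_combination -(legendre_ode K t)

lemma beta_cover (K : ℕ) (hK : 0 < K) (x : Fin K → ℝ)
    (hx : ∀ i, (legendrePoly K).eval (x i) = 0)
    (hxinj : Function.Injective x) (β : ℝ) (h0 : 0 ≤ β) (h1 : β ≤ π) :
    ∃ i, |β - arccos (x i)| ≤ 2 * π / K := by
  have hK' : (1 : ℝ) ≤ K := by exact_mod_cast hK
  have hpi := pi_pos
  by_cases hK2 : K ≤ 2
  · refine ⟨⟨0, hK⟩, ?_⟩
    have hK2' : (K : ℝ) ≤ 2 := by exact_mod_cast hK2
    have : π ≤ 2 * π / K := by rw [le_div_iff₀ (by linarith)]; nlinarith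
    have a1 := arccos_nonneg (x ⟨0, hK⟩)
    have a2 := arccos_le_pi (x ⟨0, hK⟩)
    rw [abs_le]; constructor <;> linarith
  · have hK3 : (3 : ℝ) ≤ K := by exact_mod_cast (by omega : 3 ≤ K)
    set d := 2 * π / K with hd
    set l := π / ((K : ℝ) + 1 / 2) with hl
    have hl0 : 0 < l := by positivity
    have hld : 2 * l < d := by
      rw [hl, hd, ← mul_div_assoc]
      exact div_lt_div_of_pos_left (by positivity) (by linarith) (by linarith)
    have hl2 : l * 3 < π := by
      rw [hl, div_mul_eq_mul_div, div_lt_iff₀ (by linarith)]; nlinarith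
    have hdpi : d < π := by
      rw [hd, div_lt_iff₀ (by linarith)]; nlinarith
    have key : ∃ a, 0 < a ∧ a + l < π ∧ β - d ≤ a ∧ a + l ≤ β + d := by
      rcases le_total β (π / 2) with h | h
      · exact ⟨β + l / 2, by linarith, by linarith, by linarith, by linarith⟩
      · exact ⟨β - l / 2 - l, by linarith, by linarith, by linarith, by linarith⟩
    obtain ⟨a, k1, k2, k3, k4⟩ := key
    obtain ⟨θ, hθ, hz⟩ := exists_zero K a (a + l) k1 k2 rfl
    obtain ⟨i, hi⟩ := roots_all K x hx hxinj _ hz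
    refine ⟨i, ?_⟩
    rw [hi, arccos_cos (by linarith [hθ.1]) (by linarith [hθ.2]), abs_le]
    constructor <;> linarith [hθ.1, hθ.2]

lemma alpha_cover (K : ℕ) (hK : 0 < K) (α : ℝ) (h0 : 0 ≤ α) (h1 : α ≤ 2 * π) :
    ∃ k : Fin (K + 1), |α - 2 * π * ((k : ℕ) : ℝ) / K| ≤ 2 * π / K := by
  have hK' : (0 : ℝ) < K := by exact_mod_cast hK
  have hpi := pi_pos
  have hy : 0 ≤ α * K / (2 * π) := by positivity
  have hyK : α * K / (2 * π) ≤ K := by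
    rw [div_le_iff₀ (by positivity)]; nlinarith
  refine ⟨⟨⌊α * K / (2 * π)⌋₊, Nat.lt_succ_of_le (Nat.floor_le_of_le hyK)⟩, ?_⟩
  have f1 := Nat.floor_le hy
  have f2 := (Nat.lt_floor_add_one (α * K / (2 * π))).le
  simp only
  generalize (⌊α * K / (2 * π)⌋₊ : ℝ) = n at *
  rw [le_div_iff₀ (by positivity)] at f1
  rw [div_le_iff₀ (by positivity)] at f2
  have e : α - 2 * π * n / K = (α * K - 2 * π * n) / K := by field_simp
  rw [e, abs_div, abs_of_pos hK']
  gcongr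
  rw [abs_le]; constructor <;> nlinarith

theorem sampled_max_close_to_true_max
    (L K : ℕ) (C ε : ℝ) (hL : 0 < L) (hK : 0 < K) (hC : 0 ≤ C) (hε : 0 < ε)
    (f : ℝ × ℝ × ℝ → ℝ)
    (hf : LipschitzWith (Real.toNNReal (4 * C / Real.sqrt 3 * (L : ℝ) ^ ((5 : ℝ) / 2))) f)
    -- the K Gauss–Legendre nodes: the (distinct) roots of the K-th Legendre polynomial
    (x : Fin K → ℝ)
    (hx : ∀ i, x i ∈ Set.Ioo (-1 : ℝ) 1 ∧ (legendrePoly K).eval (x i) = 0)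
    (hxinj : Function.Injective x)
    -- the sampling condition K > K₀
    (hKlarge : (K : ℝ) > 8 * π * (L : ℝ) ^ ((5 : ℝ) / 2) * (C / Real.sqrt 3) / ε) :
    sSup (f '' (Set.Icc 0 (2 * π) ×ˢ (Set.Icc 0 π ×ˢ Set.Icc 0 (2 * π)))) -
      sSup (f '' {p : ℝ × ℝ × ℝ | ∃ (k₁ : Fin (K + 1)) (k₂ : Fin K) (k₃ : Fin (K + 1)),
        p = (2 * π * k₁ / K, Real.arccos (x k₂), 2 * π * k₃ / K)}) < ε := by
  have hKp : (0 : ℝ) < K := by exact_mod_cast hK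
  have hpi := pi_pos
  set Λ : ℝ := 4 * C / Real.sqrt 3 * (L : ℝ) ^ ((5 : ℝ) / 2) with hΛ
  have hΛ0 : 0 ≤ Λ := by positivity
  have hlt : Λ * (2 * π / K) < ε := by
    rw [gt_iff_lt, div_lt_iff₀ hε] at hKlarge
    rw [← mul_div_assoc, div_lt_iff₀ hKp]
    calc Λ * (2 * π) = 8 * π * (L : ℝ) ^ ((5 : ℝ) / 2) * (C / Real.sqrt 3) := by rw [hΛ]; ring
      _ < ε * K := by linarith
  set G : Set (ℝ × ℝ × ℝ) := {p : ℝ × ℝ × ℝ | ∃ (k₁ : Fin (K + 1)) (k₂ : Fin K)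
    (k₃ : Fin (K + 1)), p = (2 * π * k₁ / K, Real.arccos (x k₂), 2 * π * k₃ / K)} with hG
  have hGfin : G.Finite := by
    refine (Set.finite_range (fun k : Fin (K + 1) × Fin K × Fin (K + 1) =>
      ((2 * π * k.1 / K, Real.arccos (x k.2.1), 2 * π * k.2.2 / K) : ℝ × ℝ × ℝ))).subset ?_
    rintro p ⟨k₁, k₂, k₃, rfl⟩
    exact ⟨(k₁, k₂, k₃), rfl⟩
  have hbdd : BddAbove (f '' G) := (hGfin.image f).bddAbove
  suffices h : sSup (f '' (Set.Icc 0 (2 * π) ×ˢ (Set.Icc 0 π ×ˢ Set.Icc 0 (2 * π))))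
      ≤ sSup (f '' G) + Λ * (2 * π / K) by linarith
  apply csSup_le
  · refine Set.Nonempty.image _ ⟨(0, 0, 0), ?_⟩
    simp [hpi.le]
  · rintro _ ⟨⟨α, β, γ⟩, ⟨hα, hβ, hγ⟩, rfl⟩
    obtain ⟨k₁, h₁⟩ := alpha_cover K hK α hα.1 hα.2
    obtain ⟨k₂, h₂⟩ := beta_cover K hK x (fun i => (hx i).2) hxinj β hβ.1 hβ.2
    obtain ⟨k₃, h₃⟩ := alpha_cover K hK γ hγ.1 hγ.2
    have hq := le_csSup hbdd (Set.mem_image_of_mem f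
      (show ((2 * π * k₁ / K, Real.arccos (x k₂), 2 * π * k₃ / K) : ℝ × ℝ × ℝ) ∈ G from
        ⟨k₁, k₂, k₃, rfl⟩))
    have hd := hf.dist_le_mul (α, β, γ) (2 * π * k₁ / K, Real.arccos (x k₂), 2 * π * k₃ / K)
    rw [Real.coe_toNNReal _ hΛ0] at hd
    have hdist : dist ((α, β, γ) : ℝ × ℝ × ℝ)
        (2 * π * k₁ / K, Real.arccos (x k₂), 2 * π * k₃ / K) ≤ 2 * π / K := by
      rw [Prod.dist_eq, Prod.dist_eq]
      simp only [Real.dist_eq]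
      exact max_le h₁ (max_le h₂ h₃)
    have hm := mul_le_mul_of_nonneg_left hdist hΛ0
    rw [Real.dist_eq] at hd
    have := le_abs_self (f (α, β, γ) - f (2 * π * k₁ / K, Real.arccos (x k₂), 2 * π * k₃ / K))
    linarith
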